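/- Let K=K(c_1,c_2,c_2,c_1) be a symmetric A_4-crystal, let v be a self-complementary vertex, and let Ktil be the middle subcrystal (colors 2,3) containing v, with source stil and sink ttil. Then stil and ttil are self-complementary, Ktil is a symmetric A_2-crystal (its parameter (g_2,g_3) satisfies g_2=g_3), and a vertex u of Ktil is self-complementary if and only if u=(F_2 F_3)^r (F_3 F_2)^r (stil) for some integer r>=0; in particular Ktil contains exactly g_2+1 self-complementary vertices. -/

import Mathlib

open Classical

noncomputable section

/-- Iterate a partial operator `k` times. -/
def optIter {V : Type} (f : V → Option V) : ℕ → V → Option V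
  | 0, v => some v
  | k + 1, v => (f v).bind (optIter f k)

/-- A vertex type together with, for every natural number (color) `i`,
a partial operator whose graph is the set of `i`-edges. -/
structure PreGraph where
  V : Type
  F : ℕ → V → Option V

namespace PreGraph

/-- Partial inverse operator of color `i`. -/
def Finv (K : PreGraph) (i : ℕ) (v : K.V) : Option K.V :=
  if h : ∃ u, K.F i u = some v then some h.choose else none

/-- Number of edges of the maximal `i`-colored path beginning at `v`. -/
def h (K : PreGraph) (i : ℕ) (v : K.V) : ℕ :=
  sSup {k | (optIter (K.F i) k v).isSome = true}

/-- Number of edges of the maximal `i`-colored path ending at `v`. -/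
def t (K : PreGraph) (i : ℕ) (v : K.V) : ℕ :=
  sSup {k | ∃ u, optIter (K.F i) k u = some v}

/-- One (undirected) step along an edge of any color. -/
def Step (K : PreGraph) (u v : K.V) : Prop :=
  ∃ i, K.F i u = some v ∨ K.F i v = some u

/-- Weak connectivity. -/
def Connected (K : PreGraph) : Prop :=
  ∀ u v : K.V, Relation.ReflTransGen K.Step u v

/-- All edges have colors in `C`. -/
def ColorsIn (K : PreGraph) (C : Set ℕ) : Prop :=
  ∀ i ∉ C, ∀ v, K.F i v = none

end PreGraph

/-- `s` has no incoming edges. -/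
def IsSource (K : PreGraph) (s : K.V) : Prop := ∀ i u, K.F i u ≠ some s

/-- `tv` has no outgoing edges. -/
def IsSink (K : PreGraph) (tv : K.V) : Prop := ∀ i, K.F i tv = none

/-- `K` is a (finite) colored graph with colors in `C` satisfying axiom (A1):
every connected monochromatic subgraph is a finite directed path. -/
def IsColored (K : PreGraph) (C : Set ℕ) : Prop :=
  Finite K.V ∧ K.ColorsIn C ∧
  (∀ (i : ℕ) (u u' v : K.V), K.F i u = some v → K.F i u' = some v → u = u') ∧
  (∀ (i : ℕ) (v : K.V) (k : ℕ), 0 < k → optIter (K.F i) k v ≠ some v)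

/-- `|i - j| = 1`. -/
def Neighb (i j : ℕ) : Prop := i + 1 = j ∨ j + 1 = i

/-- `|i - j| ≥ 2`. -/
def Far (i j : ℕ) : Prop := i + 2 ≤ j ∨ j + 2 ≤ i

instance (i j : ℕ) : Decidable (Neighb i j) := by unfold Neighb; infer_instance
instance (i j : ℕ) : Decidable (Far i j) := by unfold Far; infer_instance

/-- Axiom (A2) for the ordered pair of distinct colors `(i, j)`. -/
def A2at (K : PreGraph) (i j : ℕ) : Prop :=
  (∀ u v, K.F i u = some v →
    K.t j v ≤ K.t j u ∧ K.h j u ≤ K.h j v ∧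
    ((K.h j u : ℤ) - (K.t j u : ℤ)) - ((K.h j v : ℤ) - (K.t j v : ℤ)) =
      (if Neighb i j then (-1 : ℤ) else 0)) ∧
  (∀ u v w, K.F i u = some v → K.F i v = some w →
    2 * K.h j v ≤ K.h j u + K.h j w)

/-- Axiom (A3) for neighboring colors `i, j`. -/
def A3at (K : PreGraph) (i j : ℕ) : Prop :=
  (∀ u v v', K.F i u = some v → K.F j u = some v' →
    K.h j v = K.h j u →
    ((K.h i v' : ℤ) - (K.h i u : ℤ) = 1 ∧ ∃ w, K.F j v = some w ∧ K.F i v' = some w)) ∧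
  (∀ u u' v, K.F i u = some v → K.F j u' = some v →
    (K.h j v : ℤ) - (K.h j u : ℤ) = 1 →
    (K.h i v = K.h i u' ∧ ∃ w, K.F j w = some u ∧ K.F i w = some u'))

/-- Axiom (A4) (Verma relations) for neighboring colors `i, j`. -/
def A4at (K : PreGraph) (i j : ℕ) : Prop :=
  (∀ u v v', K.F i u = some v → K.F j u = some v' →
    (K.h j v : ℤ) - (K.h j u : ℤ) = 1 → (K.h i v' : ℤ) - (K.h i u : ℤ) = 1 →
    ∃ w, (((K.F i u).bind (K.F j)).bind (K.F j)).bind (K.F i) = some w ∧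
         (((K.F j u).bind (K.F i)).bind (K.F i)).bind (K.F j) = some w) ∧
  (∀ u u' v, K.F i u = some v → K.F j u' = some v →
    K.h j v = K.h j u → K.h i v = K.h i u' →
    ∃ w, (((K.Finv i v).bind (K.Finv j)).bind (K.Finv j)).bind (K.Finv i) = some w ∧
         (((K.Finv j v).bind (K.Finv i)).bind (K.Finv i)).bind (K.Finv j) = some w)

/-- Axiom (A5) for colors `i, j` at distance at least 2. -/
def A5at (K : PreGraph) (i j : ℕ) : Prop :=
  ∀ Fi ∈ ({K.F i, K.Finv i} : Set (K.V → Option K.V)),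
  ∀ Fj ∈ ({K.F j, K.Finv j} : Set (K.V → Option K.V)),
  ∀ v, (Fi v).isSome → (Fj v).isSome →
    ∃ w, (Fi v).bind Fj = some w ∧ (Fj v).bind Fi = some w

/-- `K` is a regular crystal of type A on the color set `C`
(an `A_{|C|}`-crystal when `C` is an integer interval). -/
def IsCrystalOn (K : PreGraph) (C : Set ℕ) : Prop :=
  IsColored K C ∧ K.Connected ∧
  (∀ i ∈ C, ∀ j ∈ C, i ≠ j → A2at K i j) ∧
  (∀ i ∈ C, ∀ j ∈ C, Neighb i j → A3at K i j ∧ A4at K i j) ∧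
  (∀ i ∈ C, ∀ j ∈ C, Far i j → A5at K i j)

/-- `K` is an `A_n`-crystal (colors `1, …, n`). -/
def IsACrystal (n : ℕ) (K : PreGraph) : Prop := IsCrystalOn K (Set.Icc 1 n)

/-- Apply a list of operators, head first. -/
def applyStr (K : PreGraph) : List ℕ → K.V → Option K.V
  | [], v => some v
  | i :: L, v => (K.F i v).bind (applyStr K L)

/-- The string `w_{m,k,j} = F_{o+j} F_{o+j+1} ⋯ F_{o+j+k-1}` (rightmost applied
first, i.e. head of the list applied first) for a crystal with colors `o+1, …, o+m`. -/
def wStr (o k j : ℕ) : List ℕ := (List.range k).map (fun m => o + j + k - 1 - m)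

/-- The string `S_{m,k} = w_{m,k,m-k+1} ⋯ w_{m,k,2} w_{m,k,1}` for a crystal with
colors `o+1, …, o+m`. -/
def SStr (o m k : ℕ) : List ℕ :=
  (List.range (m - k + 1)).flatMap fun jm => wStr o k (jm + 1)

/-- The string `S_{m,m}^{a_{o+m}} ⋯ S_{m,1}^{a_{o+1}}` for a crystal with colors
`o+1, …, o+m`, defining the principal vertex with coordinates `a`. -/
def prinStr (o m : ℕ) (a : ℕ → ℕ) : List ℕ :=
  (List.range m).flatMap fun km => (List.replicate (a (o + km + 1)) (SStr o m (km + 1))).flatten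

def prinOpt (K : PreGraph) (o m : ℕ) (s : K.V) (a : ℕ → ℕ) : Option K.V :=
  applyStr K (prinStr o m a) s

/-- `p` is the principal vertex with coordinates `a` of the crystal `K` with colors
`o+1, …, o+m` and source `s`. -/
def IsPrin (K : PreGraph) (o m : ℕ) (s : K.V) (a : ℕ → ℕ) (p : K.V) : Prop :=
  prinOpt K o m s a = some p

/-- The principal lattice of an `A_n`-crystal with source `s` and parameter `c`. -/
def PrinLat (K : PreGraph) (n : ℕ) (s : K.V) (c : ℕ → ℕ) : Set K.V :=
  {p | ∃ a : ℕ → ℕ, (∀ i, 1 ≤ i → i ≤ n → a i ≤ c i) ∧ IsPrin K 0 n s a p}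

/-- One undirected step along an edge with color in `I`. -/
def stepOn (K : PreGraph) (I : Set ℕ) (u v : K.V) : Prop :=
  ∃ i ∈ I, K.F i u = some v ∨ K.F i v = some u

/-- `u` lies in the same `I`-colored component as `v`. -/
def inComp (K : PreGraph) (I : Set ℕ) (v u : K.V) : Prop :=
  Relation.ReflTransGen (stepOn K I) v u

/-- The subcrystal of `K` with color set `I` containing `v` (the maximal connected
subgraph through `v` using only colors in `I`). -/
def PreGraph.sub (K : PreGraph) (I : Set ℕ) (v : K.V) : PreGraph where
  V := {u : K.V // inComp K I v u}
  F := fun i u =>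
    if hi : i ∈ I then
      (K.F i u.1).pbind fun w hw =>
        some ⟨w, Relation.ReflTransGen.tail u.2 ⟨i, hi, Or.inl (Option.mem_def.mp hw)⟩⟩
    else none

/-- Directed reachability. -/
def dirReach (K : PreGraph) (u v : K.V) : Prop :=
  Relation.ReflTransGen (fun a b => ∃ i, K.F i a = some b) u v

/-- The interval of `K` from `p` to `q`: the subgraph formed by all vertices and
edges lying on directed paths from `p` to `q`. -/
def PreGraph.interval (K : PreGraph) (p q : K.V) : PreGraph where
  V := {w : K.V // dirReach K p w ∧ dirReach K w q}
  F := fun i u =>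
    (K.F i u.1).pbind fun w _ =>
      if hw : dirReach K p w ∧ dirReach K w q then some ⟨w, hw⟩ else none

/-- The symmetric extract: restriction to self-complementary vertices,
with `ibar`-edges given by `chain i`. -/
def extract (K : PreGraph) (chain : ℕ → K.V → Option K.V) (σ : K.V → K.V) : PreGraph where
  V := {v : K.V // σ v = v}
  F := fun i u =>
    (chain i u.1).pbind fun w _ => if hw : σ w = w then some ⟨w, hw⟩ else none

/-- The operator chain for the color `ibar` of the symmetric extract of a
symmetric `A_{2n-1}`-crystal. -/
def chainB (K : PreGraph) (n : ℕ) (i : ℕ) (u : K.V) : Option K.V :=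
  if 1 ≤ i ∧ i ≤ n then
    (if i = n then K.F n u else (K.F i u).bind (K.F (2 * n - i)))
  else none

/-- The operator chain for the color `ibar` of the symmetric extract of a
symmetric `A_{2n}`-crystal. -/
def chainC (K : PreGraph) (n : ℕ) (i : ℕ) (u : K.V) : Option K.V :=
  if 1 ≤ i ∧ i ≤ n then
    (if i = n then (((K.F n u).bind (K.F (n + 1))).bind (K.F (n + 1))).bind (K.F n)
     else (K.F i u).bind (K.F (2 * n + 1 - i)))
  else none

/-- Symmetric extract from a symmetric `A_{2n-1}`-crystal. -/
def extractB (K : PreGraph) (n : ℕ) (σ : K.V → K.V) : PreGraph := extract K (chainB K n) σ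

/-- Symmetric extract from a symmetric `A_{2n}`-crystal. -/
def extractC (K : PreGraph) (n : ℕ) (σ : K.V → K.V) : PreGraph := extract K (chainC K n) σ

/-- Admissibility of a six-tuple `(x', y, x''; y', x, y'')` in the worm model. -/
def WormOK (g1 g2 : ℕ) : ℤ × ℤ × ℤ × ℤ × ℤ × ℤ → Prop
  | (x', y, x'', y', x, y'') =>
    (0 ≤ x' ∧ x' ≤ 2 * (g1 : ℤ)) ∧ (0 ≤ x'' ∧ x'' ≤ 2 * (g1 : ℤ)) ∧
    (0 ≤ x ∧ x ≤ 2 * (g1 : ℤ)) ∧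
    (0 ≤ y' ∧ y' ≤ (g2 : ℤ)) ∧ (0 ≤ y'' ∧ y'' ≤ (g2 : ℤ)) ∧ (0 ≤ y ∧ y ≤ (g2 : ℤ)) ∧
    (2 ∣ x') ∧ (2 ∣ x'') ∧ (y' ≤ y ∧ y ≤ y'') ∧ (x' ≤ x ∧ x ≤ x'') ∧
    (y' < y → x' = x) ∧ (y < y'' → x = x'')

/-- The candidate image of a worm under the operator `1tilde`. -/
def worm1 : ℤ × ℤ × ℤ × ℤ × ℤ × ℤ → ℤ × ℤ × ℤ × ℤ × ℤ × ℤ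
  | (x', y, x'', y', x, y'') =>
    if 2 * x > x' + x'' then (x' + 2, y, x'', y', x, y'')
    else if x = x' ∧ x' = x'' ∧ y < y'' then (x', y + 1, x'', y', x, y'')
    else (x', y, x'' + 2, y', x, y'')

/-- The candidate image of a worm under the operator `2tilde`. -/
def worm2 : ℤ × ℤ × ℤ × ℤ × ℤ × ℤ → ℤ × ℤ × ℤ × ℤ × ℤ × ℤ
  | (x', y, x'', y', x, y'') =>
    if 2 * y > y' + y'' then (x', y, x'', y' + 1, x, y'')
    else if y' = y ∧ y = y'' ∧ x < x'' then (x', y, x'', y', x + 1, y'')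
    else (x', y, x'', y', x, y'' + 1)

/-- The worm graph `W(g1, g2)`, with colors `1 = 1tilde` and `2 = 2tilde`. -/
def WormGraph (g1 g2 : ℕ) : PreGraph where
  V := {w : ℤ × ℤ × ℤ × ℤ × ℤ × ℤ // WormOK g1 g2 w}
  F := fun i u =>
    if i = 1 then
      (if h1 : WormOK g1 g2 (worm1 u.1) then some ⟨worm1 u.1, h1⟩ else none)
    else if i = 2 then
      (if h2 : WormOK g1 g2 (worm2 u.1) then some ⟨worm2 u.1, h2⟩ else none)
    else none

/-- Isomorphism of colored graphs, renaming colors via `φ`. -/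
def IsoVia (K L : PreGraph) (φ : ℕ → ℕ) : Prop :=
  ∃ e : K.V ≃ L.V, ∀ i u v, K.F i u = some v ↔ L.F (φ i) (e u) = some (e v)

/-- The Cartesian product of an `i`-path of length `p` and a `j`-path of length `q`. -/
def boxGraph (i j p q : ℕ) : PreGraph where
  V := Fin (p + 1) × Fin (q + 1)
  F := fun s u =>
    if s = i then
      (if h : (u.1 : ℕ) < p then some (⟨(u.1 : ℕ) + 1, by omega⟩, u.2) else none)
    else if s = j then
      (if h : (u.2 : ℕ) < q then some (u.1, ⟨(u.2 : ℕ) + 1, by omega⟩) else none)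
    else none

/-- `B_n`-crystal: components with colors `n-1, n` are worm graphs,
with color `n-1` corresponding to `1tilde` and `n` to `2tilde`. -/
def IsBCrystal (n : ℕ) (B : PreGraph) : Prop :=
  IsColored B (Set.Icc 1 n) ∧ B.Connected ∧
  (∀ i ∈ Set.Icc 1 n, ∀ j ∈ Set.Icc 1 n, Far i j → A5at B i j) ∧
  (∀ i j, 1 ≤ i → i < n → 1 ≤ j → j < n → Neighb i j →
    ∀ v : B.V, IsCrystalOn (B.sub {i, j} v) {i, j}) ∧
  (∀ v : B.V, ∃ g1 g2 : ℕ,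
    IsoVia (B.sub ({n - 1, n} : Set ℕ) v) (WormGraph g1 g2)
      (fun x => if x = n - 1 then 1 else if x = n then 2 else 0))

/-- `C_n`-crystal: components with colors `n-1, n` are worm graphs,
with color `n-1` corresponding to `2tilde` and `n` to `1tilde`. -/
def IsCCrystal (n : ℕ) (B : PreGraph) : Prop :=
  IsColored B (Set.Icc 1 n) ∧ B.Connected ∧
  (∀ i ∈ Set.Icc 1 n, ∀ j ∈ Set.Icc 1 n, Far i j → A5at B i j) ∧
  (∀ i j, 1 ≤ i → i < n → 1 ≤ j → j < n → Neighb i j →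
    ∀ v : B.V, IsCrystalOn (B.sub {i, j} v) {i, j}) ∧
  (∀ v : B.V, ∃ g1 g2 : ℕ,
    IsoVia (B.sub ({n - 1, n} : Set ℕ) v) (WormGraph g1 g2)
      (fun x => if x = n - 1 then 2 else if x = n then 1 else 0))

/-! ### The crossing model -/

/-- `(k, i, j)` is a node `v_i^k(j)` of the supporting graph `G` for rank `n`. -/
def isNode (n k i j : ℕ) : Prop :=
  1 ≤ j ∧ j ≤ i ∧ i ≤ n ∧ i - j + 1 ≤ k ∧ k ≤ n - j + 1

instance (n k i j : ℕ) : Decidable (isNode n k i j) := by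
  unfold isNode; infer_instance

/-- Extension of a function on the nodes of `G` to the extended supporting graph:
extra nodes from which `G^k` is reachable get value `c k`, the others get `0`. -/
def fext (n : ℕ) (c : ℕ → ℕ) (f : ℕ × ℕ × ℕ → ℤ) (k i j : ℕ) : ℤ :=
  if isNode n k i j then f (k, i, j)
  else if j ≤ n - k + 1 then (c k : ℤ) else 0

/-- The slack at the node `v_i^k(j)`. -/
def epsN (n : ℕ) (c : ℕ → ℕ) (f : ℕ × ℕ × ℕ → ℤ) (k i j : ℕ) : ℤ :=
  (fext n c f k (i - 1) (j - 1) - fext n c f k i j) -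
    (fext n c f k i (j - 1) - fext n c f k (i + 1) j)

/-- The total slack at the multinode `V_i(j)`. -/
def epsTot (n : ℕ) (c : ℕ → ℕ) (f : ℕ × ℕ × ℕ → ℤ) (i j : ℕ) : ℤ :=
  ∑ k ∈ Finset.Icc (i - j + 1) (n - j + 1), epsN n c f k i j

/-- The reduced slack at the multinode `V_i(j)`. -/
def teps (n : ℕ) (c : ℕ → ℕ) (f : ℕ × ℕ × ℕ → ℤ) (i j : ℕ) : ℤ :=
  if hj : (Finset.Icc 1 j).Nonempty then
    max 0 ((Finset.Icc 1 j).inf' hj fun p => ∑ q ∈ Finset.Icc p j, epsTot n c f i q)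
  else 0

/-- `k0` satisfies the switch condition in the multinode `V_i(j)`. -/
def switchCond (n : ℕ) (f : ℕ × ℕ × ℕ → ℤ) (i j k0 : ℕ) : Prop :=
  i - j + 1 ≤ k0 ∧ k0 ≤ n - j + 1 ∧
  (∀ k, i - j + 1 ≤ k → k < k0 → isNode n k (i + 1) (j + 1) →
    f (k, i, j) = f (k, i + 1, j + 1)) ∧
  (∀ k, k0 < k → k ≤ n - j + 1 → isNode n k (i + 1) j →
    f (k, i + 1, j) = f (k, i, j))

/-- The switch-node (first node with the switch property) of the multinode `V_i(j)`. -/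
def switchNode (n : ℕ) (f : ℕ × ℕ × ℕ → ℤ) (i j : ℕ) : ℕ :=
  sInf {k0 | switchCond n f i j k0}

/-- Feasible functions of the crossing model (normalized to vanish off the nodes). -/
def Feasible (n : ℕ) (c : ℕ → ℕ) (f : ℕ × ℕ × ℕ → ℤ) : Prop :=
  (∀ k i j, ¬ isNode n k i j → f (k, i, j) = 0) ∧
  (∀ k i j, isNode n k i j → isNode n k (i - 1) j → f (k, i - 1, j) ≤ f (k, i, j)) ∧
  (∀ k i j, isNode n k i j → isNode n k (i + 1) (j + 1) → f (k, i + 1, j + 1) ≤ f (k, i, j)) ∧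
  (∀ k i j, isNode n k i j → 0 ≤ f (k, i, j) ∧ f (k, i, j) ≤ (c k : ℤ)) ∧
  (∀ i j, 1 ≤ j → j ≤ i → i ≤ n → ∃ k0, switchCond n f i j k0)

/-- Increase `f` by one at the node `(k, i, j)`. -/
def bump (f : ℕ × ℕ × ℕ → ℤ) (k i j : ℕ) : ℕ × ℕ × ℕ → ℤ :=
  fun x => if x = (k, i, j) then f x + 1 else f x

/-- The crossing-model graph `Kscr(c)`: vertices are the feasible functions, and
the move `φ_i` increases `f` by one at the switch-node of the active multinode. -/
def Kscr (n : ℕ) (c : ℕ → ℕ) : PreGraph where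
  V := {f : ℕ × ℕ × ℕ → ℤ // Feasible n c f}
  F := fun i f =>
    if 1 ≤ i ∧ i ≤ n ∧ ∃ j, 1 ≤ j ∧ j ≤ i ∧ 0 < teps n c f.1 i j then
      (let j := sSup {j | 1 ≤ j ∧ j ≤ i ∧ 0 < teps n c f.1 i j}
       let g := bump f.1 (switchNode n f.1 i j) i j
       if hg : Feasible n c g then some ⟨g, hg⟩ else none)
    else none

/-- The function `f_{a,D}` of the crossing model. -/
def faD (n : ℕ) (a : ℕ → ℕ) (D : ℕ → ℤ) : ℕ × ℕ × ℕ → ℤ := fun x =>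
  if isNode n x.1 x.2.1 x.2.2 then
    (if x.2.1 - x.2.2 + 1 = x.1 then (a x.1 : ℤ) else (a x.1 : ℤ) + min (D (x.1 - 1)) 0) +
    (if x.2.2 ≤ n - x.1 then max (D x.1) 0 else 0)
  else 0

/-! ### Descriptions of self-complementary vertices -/

/-- `(a1, a2, δ, l)` is the description of a self-complementary vertex `v` of a
symmetric `A_3`-crystal `K` with source `s` and parameter `c`. -/
def IsDescB (K : PreGraph) (s : K.V) (c : ℕ → ℕ) (v : K.V) (q : ℕ × ℕ × ℤ × ℕ) : Prop :=
  q.2.2.2 = K.t 2 v ∧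
  ∃ (a : ℕ → ℕ) (pa : K.V),
    a 1 = q.1 ∧ a 2 = q.2.1 ∧ a 3 = ((q.1 : ℤ) + max q.2.2.1 0).toNat ∧
    (∀ i, 1 ≤ i → i ≤ 3 → a i ≤ c i) ∧
    IsPrin K 0 3 s a pa ∧ inComp K (Set.Icc 1 2) pa v ∧
    0 ≤ (q.2.1 : ℤ) + q.2.2.1 ∧ 0 ≤ (a 3 : ℤ) - q.2.2.1 ∧
    ∃ s' : (K.sub (Set.Icc 1 2) pa).V, IsSource (K.sub (Set.Icc 1 2) pa) s' ∧
    ∃ z : (K.sub (Set.Icc 1 2) pa).V,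
      IsPrin (K.sub (Set.Icc 1 2) pa) 0 2 s'
        (fun i => if i = 1 then ((q.2.1 : ℤ) + q.2.2.1).toNat else ((a 3 : ℤ) - q.2.2.1).toNat) z ∧
      inComp K ({2} : Set ℕ) z.1 v

/-- The polytope of descriptions for a symmetric `A_3`-crystal with parameter `(c1, c2, c1)`. -/
def QuadB (c1 c2 : ℕ) : Set (ℕ × ℕ × ℤ × ℕ) :=
  {q | q.1 ≤ c1 ∧ q.2.1 ≤ c2 ∧ -(q.2.1 : ℤ) ≤ q.2.2.1 ∧ (q.2.1 : ℤ) - (c2 : ℤ) ≤ q.2.2.1 ∧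
       q.2.2.1 ≤ (c1 : ℤ) - (q.1 : ℤ) ∧ (q.2.2.2 : ℤ) ≤ (c2 : ℤ) + 2 * q.2.2.1}

/-- The worm associated to the description `(a1, a2, δ, l)`. -/
def wtupleB (a1 a2 : ℕ) (δ : ℤ) (l : ℕ) : ℤ × ℤ × ℤ × ℤ × ℤ × ℤ :=
  let a3 : ℤ := (a1 : ℤ) + max δ 0
  let tr : ℤ × ℤ × ℤ :=
    if 0 ≤ δ then
      if (l : ℤ) ≤ (a2 : ℤ) then ((l : ℤ), 2 * (a1 : ℤ), (a2 : ℤ))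
      else if (l : ℤ) ≤ (a2 : ℤ) + 2 * δ then
        ((a2 : ℤ), 2 * (a1 : ℤ) + (l : ℤ) - (a2 : ℤ), (a2 : ℤ))
      else ((a2 : ℤ), 2 * a3, (l : ℤ) - 2 * δ)
    else
      if (l : ℤ) ≤ (a2 : ℤ) + δ then ((l : ℤ), 2 * (a1 : ℤ), (a2 : ℤ) - δ)
      else ((a2 : ℤ) + δ, 2 * (a1 : ℤ), (l : ℤ) - 2 * δ)
  (2 * (a1 : ℤ), (a2 : ℤ), 2 * a3, tr.1, tr.2.1, tr.2.2)

def wtQ (q : ℕ × ℕ × ℤ × ℕ) : ℤ × ℤ × ℤ × ℤ × ℤ × ℤ :=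
  wtupleB q.1 q.2.1 q.2.2.1 q.2.2.2

/-- The string `(F_2 F_3)^r (F_3 F_2)^r` (rightmost applied first). -/
def diagStr (r : ℕ) : List ℕ :=
  (List.replicate r ([2, 3] : List ℕ)).flatten ++ (List.replicate r ([3, 2] : List ℕ)).flatten

/-- `(a1, a2, δ, ρ)` is the description of a self-complementary vertex `v` of a
symmetric `A_4`-crystal `K` with source `s` and parameter `c`. -/
def IsDescC (K : PreGraph) (s : K.V) (c : ℕ → ℕ) (v : K.V) (q : ℕ × ℕ × ℤ × ℕ) : Prop :=
  ∃ (a : ℕ → ℕ) (pa : K.V),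
    a 1 = q.1 ∧ a 2 = q.2.1 ∧ a 3 = ((q.2.1 : ℤ) + min q.2.2.1 0).toNat ∧
    a 4 = ((q.1 : ℤ) + max q.2.2.1 0).toNat ∧
    (∀ i, 1 ≤ i → i ≤ 4 → a i ≤ c i) ∧
    IsPrin K 0 4 s a pa ∧ inComp K (Set.Icc 1 3) pa v ∧
    0 ≤ (q.2.1 : ℤ) + q.2.2.1 ∧ 0 ≤ (a 4 : ℤ) - q.2.2.1 ∧
    (∃ s' : (K.sub (Set.Icc 1 3) pa).V, IsSource (K.sub (Set.Icc 1 3) pa) s' ∧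
     ∃ z : (K.sub (Set.Icc 1 3) pa).V,
       IsPrin (K.sub (Set.Icc 1 3) pa) 0 3 s'
         (fun i => if i = 1 then ((q.2.1 : ℤ) + q.2.2.1).toNat
                   else if i = 2 then a 3 else ((a 4 : ℤ) - q.2.2.1).toNat) z ∧
       inComp K (Set.Icc 2 3) z.1 v) ∧
    (∃ stil : (K.sub (Set.Icc 2 3) v).V, IsSource (K.sub (Set.Icc 2 3) v) stil ∧
       applyStr (K.sub (Set.Icc 2 3) v) (diagStr q.2.2.2) stil =
         some ⟨v, Relation.ReflTransGen.refl⟩)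

/-- The polytope of descriptions for a symmetric `A_4`-crystal with parameter
`(c1, c2, c2, c1)`. -/
def QuadC (c1 c2 : ℕ) : Set (ℕ × ℕ × ℤ × ℕ) :=
  {q | q.1 ≤ c1 ∧ q.2.1 ≤ c2 ∧ -(q.2.1 : ℤ) ≤ q.2.2.1 ∧
       q.2.2.1 ≤ (c1 : ℤ) - (q.1 : ℤ) ∧ (q.2.2.2 : ℤ) ≤ (c2 : ℤ) + q.2.2.1}

end

section Crystal

variable {K : PreGraph}

theorem optIter_add {V : Type} (f : V → Option V) (a b : ℕ) (v : V) :
    optIter f (a + b) v = (optIter f a v).bind (optIter f b) := by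
  induction a generalizing v with
  | zero => simp [optIter]
  | succ a ih =>
    rw [Nat.succ_add]
    simp only [optIter]
    cases f v with
    | none => rfl
    | some w => simpa using ih w

theorem optIter_succ' {V : Type} (f : V → Option V) (k : ℕ) (v : V) :
    optIter f (k + 1) v = (optIter f k v).bind f := by
  rw [optIter_add]
  congr 1
  funext w
  simp [optIter]

/-- The lengths of monochromatic paths starting at a given vertex are bounded. -/
theorem bddAbove_optIter {C : Set ℕ} (hK : IsColored K C) (i : ℕ) (v : K.V) :
    BddAbove {k | (optIter (K.F i) k v).isSome = true} := by
  by_contra hb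
  have hfin : Finite K.V := hK.1
  have hall : ∀ k, ∃ w, optIter (K.F i) k v = some w := by
    intro k
    rw [not_bddAbove_iff] at hb
    obtain ⟨m, hm, hkm⟩ := hb k
    obtain ⟨d, rfl⟩ := Nat.exists_eq_add_of_lt hkm
    have hm' : (optIter (K.F i) (k + d + 1) v).isSome = true := hm
    rw [Nat.add_assoc, optIter_add] at hm'
    cases h : optIter (K.F i) k v with
    | none => simp [h] at hm'
    | some w => exact ⟨w, rfl⟩
  choose g hg using hall
  have hlt : ∀ a b, a < b → g a ≠ g b := by
    intro a b hab hgab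
    obtain ⟨d, rfl⟩ := Nat.exists_eq_add_of_lt hab
    have h1 := hg (a + d + 1)
    rw [Nat.add_assoc, optIter_add, hg a, ← Nat.add_assoc, ← hgab] at h1
    exact hK.2.2.2 i (g a) (d + 1) (Nat.succ_pos d) h1
  have hinj : Function.Injective g := by
    intro a b hab
    rcases lt_trichotomy a b with h | h | h
    · exact absurd hab (hlt a b h)
    · exact h
    · exact absurd hab.symm (hlt b a h)
  exact not_injective_infinite_finite g hinj

/-- The lengths of monochromatic paths ending at a given vertex are bounded. -/
theorem bddAbove_optIter_end {C : Set ℕ} (hK : IsColored K C) (i : ℕ) (v : K.V) :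
    BddAbove {k | ∃ u, optIter (K.F i) k u = some v} := by
  have hfin : Finite K.V := hK.1
  obtain ⟨N, hN⟩ := (Set.finite_range (K.h i)).bddAbove
  refine ⟨N, ?_⟩
  rintro k ⟨u, hu⟩
  exact (le_csSup (bddAbove_optIter hK i u) (by simp [hu])).trans (hN ⟨u, rfl⟩)

theorem h_eq_succ {C : Set ℕ} (hK : IsColored K C) {i : ℕ} {u v : K.V}
    (huv : K.F i u = some v) : K.h i u = K.h i v + 1 := by
  apply le_antisymm
  · refine csSup_le ⟨0, by simp [optIter]⟩ ?_
    intro k hk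
    cases k with
    | zero => omega
    | succ k =>
      have : (optIter (K.F i) k v).isSome = true := by simpa [optIter, huv] using hk
      exact Nat.succ_le_succ (le_csSup (bddAbove_optIter hK i v) this)
  · have hv : (optIter (K.F i) (K.h i v) v).isSome = true :=
      Nat.sSup_mem (s := {k | (optIter (K.F i) k v).isSome = true})
        ⟨0, by simp [optIter]⟩ (bddAbove_optIter hK i v)
    exact le_csSup (bddAbove_optIter hK i u) (by simpa [optIter, huv] using hv)

theorem t_eq_succ {C : Set ℕ} (hK : IsColored K C) {i : ℕ} {u v : K.V}
    (huv : K.F i u = some v) : K.t i v = K.t i u + 1 := by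
  apply le_antisymm
  · refine csSup_le ⟨0, v, rfl⟩ ?_
    rintro k ⟨w, hw⟩
    cases k with
    | zero => omega
    | succ k =>
      rw [optIter_succ', Option.bind_eq_some_iff] at hw
      obtain ⟨u', hu', hu'v⟩ := hw
      obtain rfl := hK.2.2.1 i u u' v huv hu'v
      exact Nat.succ_le_succ (le_csSup (bddAbove_optIter_end hK i u) ⟨w, hu'⟩)
  · obtain ⟨w, hw⟩ : ∃ w, optIter (K.F i) (K.t i u) w = some u :=
      Nat.sSup_mem (s := {k | ∃ w, optIter (K.F i) k w = some u})
        ⟨0, u, rfl⟩ (bddAbove_optIter_end hK i u)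
    refine le_csSup (bddAbove_optIter_end hK i v) ⟨w, ?_⟩
    rw [optIter_succ', hw]
    exact huv

theorem exists_of_h_pos {i : ℕ} {u : K.V} (hu : 0 < K.h i u) : ∃ v, K.F i u = some v := by
  by_contra hne
  have hnone : K.F i u = none := by
    cases hF : K.F i u with
    | none => rfl
    | some v => exact absurd ⟨v, hF⟩ hne
  have : K.h i u ≤ 0 := by
    refine csSup_le ⟨0, by simp [optIter]⟩ ?_
    intro k hk
    cases k with
    | zero => exact le_rfl
    | succ k => simp [optIter, hnone] at hk
  omega

theorem exists_of_t_pos {i : ℕ} {v : K.V} (hv : 0 < K.t i v) : ∃ u, K.F i u = some v := by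
  by_contra hne
  have : K.t i v ≤ 0 := by
    refine csSup_le ⟨0, v, rfl⟩ ?_
    rintro k ⟨w, hw⟩
    cases k with
    | zero => exact le_rfl
    | succ k =>
      rw [optIter_succ', Option.bind_eq_some_iff] at hw
      obtain ⟨u', -, hu'v⟩ := hw
      exact absurd ⟨u', hu'v⟩ hne
  omega

theorem Finv_eq_some_iff {C : Set ℕ} (hK : IsColored K C) {i : ℕ} {u v : K.V} :
    K.Finv i v = some u ↔ K.F i u = some v := by
  unfold PreGraph.Finv
  split_ifs with hex
  · constructor
    · intro h
      rw [← Option.some.inj h]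
      exact hex.choose_spec
    · intro h
      rw [hK.2.2.1 i _ _ _ hex.choose_spec h]
  · constructor
    · intro h
      cases h
    · intro h
      exact absurd ⟨u, h⟩ hex

theorem Neighb.symm {i j : ℕ} (hn : Neighb i j) : Neighb j i := Or.symm hn

theorem Neighb.ne {i j : ℕ} (hn : Neighb i j) : i ≠ j := by
  unfold Neighb at hn
  omega

theorem mem_of_edge {C : Set ℕ} (hK : IsColored K C) {i : ℕ} {u v : K.V}
    (huv : K.F i u = some v) : i ∈ C := by
  by_contra hi
  rw [hK.2.1 i hi u] at huv
  cases huv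

/-- The label of an edge with respect to a neighboring color is `0` or `1`. -/
theorem label_cases {C : Set ℕ} (hK : IsCrystalOn K C) {i j : ℕ} (hi : i ∈ C) (hj : j ∈ C)
    (hn : Neighb i j) {u v : K.V} (huv : K.F i u = some v) :
    (K.h j v = K.h j u ∧ K.t j u = K.t j v + 1) ∨
      (K.h j v = K.h j u + 1 ∧ K.t j v = K.t j u) := by
  have h := (hK.2.2.1 i hi j hj hn.ne).1 u v huv
  rw [if_pos hn] at h
  omega

/-! ### Critical vertices -/

/-- All edges of colors `i`, `j` entering `v` have label `0`, and those leaving it label `1`. -/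
def IsCritical (K : PreGraph) (i j : ℕ) (v : K.V) : Prop :=
  (∀ u, K.F i v = some u → K.h j u = K.h j v + 1) ∧
  (∀ u, K.F j v = some u → K.h i u = K.h i v + 1) ∧
  (∀ u, K.F i u = some v → K.h j v = K.h j u) ∧
  (∀ u, K.F j u = some v → K.h i v = K.h i u)

theorem IsCritical.symm {i j : ℕ} {v : K.V} (h : IsCritical K i j v) : IsCritical K j i v :=
  ⟨h.2.1, h.1, h.2.2.2, h.2.2.1⟩

theorem IsSource.t_eq_zero {s : K.V} (hs : IsSource K s) (i : ℕ) : K.t i s = 0 := by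
  by_contra hne
  obtain ⟨u, hu⟩ := exists_of_t_pos (Nat.pos_of_ne_zero hne)
  exact hs i u hu

theorem IsSource.isCritical {C : Set ℕ} (hK : IsCrystalOn K C) {i j : ℕ} (hi : i ∈ C)
    (hj : j ∈ C) (hn : Neighb i j) {s : K.V} (hs : IsSource K s) : IsCritical K i j s := by
  refine ⟨fun u hu => ?_, fun u hu => ?_, fun u hu => absurd hu (hs i u),
    fun u hu => absurd hu (hs j u)⟩
  · have := label_cases hK hi hj hn hu
    have := hs.t_eq_zero j
    omega
  · have := label_cases hK hj hi hn.symm hu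
    have := hs.t_eq_zero i
    omega

/-- The operators `F_i F_j F_j F_i` and `F_j F_i F_i F_j` agree at a critical vertex. -/
theorem IsCritical.verma {C : Set ℕ} (hK : IsCrystalOn K C) {i j : ℕ} (hi : i ∈ C)
    (hj : j ∈ C) (hn : Neighb i j) {v : K.V} (hv : IsCritical K i j v)
    (hiv : 0 < K.h i v) (hjv : 0 < K.h j v) :
    ∃ w, applyStr K [i, j, j, i] v = some w ∧ applyStr K [j, i, i, j] v = some w := by
  obtain ⟨x, hx⟩ := exists_of_h_pos hiv
  obtain ⟨z, hz⟩ := exists_of_h_pos hjv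
  have hx1 := hv.1 x hx
  have hz1 := hv.2.1 z hz
  obtain ⟨w, hw1, hw2⟩ := (hK.2.2.2.1 i hi j hj hn).2.1 v x z hx hz (by omega) (by omega)
  refine ⟨w, ?_, ?_⟩
  · rw [← hw1]
    simp [applyStr, Option.bind_assoc]
  · rw [← hw2]
    simp [applyStr, Option.bind_assoc]

/-- The operator `F_j F_i` moves a critical vertex to a critical one. -/
theorem IsCritical.step {C : Set ℕ} (hK : IsCrystalOn K C) {i j : ℕ} (hi : i ∈ C)
    (hj : j ∈ C) (hn : Neighb i j) {v x : K.V} (hv : IsCritical K i j v)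
    (hx : K.F i v = some x) :
    ∃ y, K.F j x = some y ∧ IsCritical K i j y ∧ K.h i v = K.h i y + 1 ∧
      K.h j y = K.h j v := by
  have hA3 := (hK.2.2.2.1 i hi j hj hn).1
  have hA3' := (hK.2.2.2.1 j hj i hi hn.symm).1
  have hinj := hK.1.2.2.1
  have hlx := hv.1 x hx
  have hhx := h_eq_succ hK.1 hx
  have htx := t_eq_succ hK.1 hx
  obtain ⟨y, hy⟩ := exists_of_h_pos (K := K) (i := j) (u := x) (by omega)
  have hhy := h_eq_succ hK.1 hy
  -- the edge from `x` to `y` has label `0`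
  have hly : K.h i y = K.h i x := by
    rcases label_cases hK hj hi hn.symm hy with h | h
    · exact h.1
    · exfalso
      obtain ⟨z, hz⟩ := exists_of_t_pos (K := K) (i := i) (v := y) (by omega)
      obtain ⟨h1, w, hw1, hw2⟩ := hA3'.2 x z y hy hz (by omega)
      obtain rfl := hinj i w v x hw1 hx
      have := h_eq_succ hK.1 hw2
      omega
  -- the two composites `F_j F_i` and `F_i F_j` differ at `v`
  have hne : ∀ z, K.F j v = some z → K.F i z ≠ some y := by
    intro z hz hzy
    have := hv.2.1 z hz
    have := h_eq_succ hK.1 hzy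
    omega
  refine ⟨y, hy, ⟨?_, ?_, ?_, ?_⟩, by omega, by omega⟩
  · intro y2 hy2
    have hpos := h_eq_succ hK.1 hy2
    obtain ⟨x2, hx2⟩ := exists_of_h_pos (K := K) (i := i) (u := x) (by omega)
    obtain ⟨h1, w, hw1, hw2⟩ := hA3'.1 x y x2 hy hx2 hly
    obtain rfl : y2 = w := Option.some.inj (hy2.symm.trans hw1)
    have := h_eq_succ hK.1 hw2
    omega
  · intro y' hy'
    rcases label_cases hK hj hi hn.symm hy' with h | h
    · exfalso
      have hhy' := h_eq_succ hK.1 hy'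
      obtain ⟨w, hw1, hw2⟩ := hv.verma hK hi hj hn (by omega) (by omega)
      obtain ⟨z, hz⟩ := exists_of_h_pos (K := K) (i := j) (u := v) (by omega)
      have hw1' : K.F i y' = some w := by simpa [applyStr, hx, hy, hy'] using hw1
      have hpos := h_eq_succ hK.1 hw1'
      obtain ⟨q, hq⟩ := exists_of_h_pos (K := K) (i := i) (u := y) (by omega)
      obtain ⟨-, w', hw'1, hw'2⟩ := hA3'.1 y y' q hy' hq h.1
      obtain rfl : w = w' := Option.some.inj (hw1'.symm.trans hw'1)
      simp only [applyStr, hz, Option.bind_some, Option.bind_eq_some_iff] at hw2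
      obtain ⟨a, ha, b, hb, d, hd, hdw⟩ := hw2
      obtain rfl := Option.some.inj hdw
      obtain rfl := hinj j _ _ _ hd hw'2
      obtain rfl := hinj i _ _ _ hb hq
      exact hne z hz ha
    · exact h.1
  · intro y0 hy0
    rcases label_cases hK hi hj hn hy0 with h | h
    · exact h.1
    · exfalso
      obtain ⟨-, w, hw1, hw2⟩ := hA3.2 y0 x y hy0 hy (by omega)
      obtain rfl := hinj i w v x hw2 hx
      exact hne y0 hw1 hy0
  · intro x' hx'
    obtain rfl := hinj j x' x y hx' hy
    exact hly

theorem applyStr_append (l l' : List ℕ) (v : K.V) :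
    applyStr K (l ++ l') v = (applyStr K l v).bind (applyStr K l') := by
  induction l generalizing v with
  | nil => simp [applyStr]
  | cons i l ih =>
    simp only [List.cons_append, applyStr, Option.bind_assoc]
    congr 1
    funext w
    exact ih w

theorem IsCritical.le_h_of_applyStr {C : Set ℕ} (hK : IsCrystalOn K C) {i j : ℕ} (hi : i ∈ C)
    (hj : j ∈ C) (hn : Neighb i j) {r : ℕ} {v u : K.V} (hv : IsCritical K i j v)
    (hu : applyStr K (List.replicate r [i, j]).flatten v = some u) : r ≤ K.h i v := by
  induction r generalizing v with
  | zero => omega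
  | succ r ih =>
    simp only [List.replicate_succ, List.flatten_cons, applyStr_append, applyStr,
      Option.bind_eq_some_iff] at hu
    obtain ⟨y, ⟨x, hx, y', hy', hyy'⟩, hyu⟩ := hu
    obtain rfl := Option.some.inj hyy'
    obtain ⟨y, hy, hcy, h1, -⟩ := hv.step hK hi hj hn hx
    obtain rfl := Option.some.inj (hy'.symm.trans hy)
    have := ih hcy hyu
    omega

/-- Powers of `F_j F_i` commute with `F_i F_j` at critical vertices. -/
theorem IsCritical.applyStr_comm {C : Set ℕ} (hK : IsCrystalOn K C) {i j : ℕ} (hi : i ∈ C)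
    (hj : j ∈ C) (hn : Neighb i j) {r : ℕ} {v : K.V} (hv : IsCritical K i j v)
    (hr : r ≤ K.h i v) (hjv : 0 < K.h j v) :
    applyStr K ((List.replicate r [i, j]).flatten ++ [j, i]) v =
      applyStr K ([j, i] ++ (List.replicate r [i, j]).flatten) v := by
  induction r generalizing v with
  | zero => simp
  | succ r ih =>
    obtain ⟨x, hx⟩ := exists_of_h_pos (K := K) (i := i) (u := v) (by omega)
    obtain ⟨y, hy, hcy, h1, h2⟩ := hv.step hK hi hj hn hx
    have hstep : ∀ l, applyStr K ([i, j] ++ l) v = applyStr K l y := by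
      intro l
      simp [applyStr, hx, hy]
    obtain ⟨w, hw1, hw2⟩ := hv.verma hK hi hj hn (by omega) hjv
    have hcomm : applyStr K ([j, i] ++ [i, j]) v = applyStr K [j, i] y := by
      rw [← hstep]
      exact hw2.trans hw1.symm
    rw [List.replicate_succ, List.flatten_cons, List.append_assoc, hstep,
      ih hcy (by omega) (by omega), ← List.append_assoc, applyStr_append ([j, i] ++ [i, j]),
      hcomm, applyStr_append]

/-! ### Diagonal vertices -/

theorem mem_two : 2 ∈ Set.Icc 2 3 := by decide

theorem mem_three : 3 ∈ Set.Icc 2 3 := by decide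

theorem neighb_two_three : Neighb 2 3 := Or.inl rfl

theorem diagStr_succ_of_isCritical (hK : IsCrystalOn K (Set.Icc 2 3)) {v : K.V}
    (hv : IsCritical K 2 3 v) (h2 : 0 < K.h 2 v) (h3 : 0 < K.h 3 v) :
    ∃ w, applyStr K [2, 3, 3, 2] v = some w ∧ applyStr K [3, 2, 2, 3] v = some w ∧
      IsCritical K 2 3 w ∧ K.h 2 v = K.h 2 w + 1 ∧ K.h 3 v = K.h 3 w + 1 ∧
      ∀ r, r + 1 ≤ K.h 2 v → applyStr K (diagStr (r + 1)) v = applyStr K (diagStr r) w := by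
  have hn := neighb_two_three
  obtain ⟨x, hx⟩ := exists_of_h_pos h2
  obtain ⟨y, hy, hcy, hy2, hy3⟩ := hv.step hK mem_two mem_three hn hx
  obtain ⟨x', hx'⟩ := exists_of_h_pos (K := K) (i := 3) (u := y) (by omega)
  obtain ⟨w, hw, hcw, hw3, hw2⟩ := hcy.symm.step hK mem_three mem_two hn.symm hx'
  obtain ⟨w', hw'1, hw'2⟩ := hv.verma hK mem_two mem_three hn h2 h3
  have hw1 : applyStr K [2, 3, 3, 2] v = some w := by simp [applyStr, hx, hy, hx', hw]
  obtain rfl := Option.some.inj (hw1.symm.trans hw'1)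
  refine ⟨w, hw1, hw'2, hcw.symm, by omega, by omega, fun r hr => ?_⟩
  have hcomm := hcy.applyStr_comm hK mem_two mem_three hn (r := r) (by omega) (by omega)
  have hstep : ∀ l, applyStr K ([2, 3] ++ l) v = applyStr K l y := by
    intro l
    simp [applyStr, hx, hy]
  have hstep' : ∀ l, applyStr K ([3, 2] ++ l) y = applyStr K l w := by
    intro l
    simp [applyStr, hx', hw]
  unfold diagStr
  rw [List.replicate_succ, List.replicate_succ, List.flatten_cons, List.flatten_cons,
    List.append_assoc, hstep, ← List.append_assoc, applyStr_append, hcomm, hstep',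
    ← applyStr_append]

theorem diagStr_succ_apply (hK : IsCrystalOn K (Set.Icc 2 3)) {r : ℕ} {v u : K.V}
    (hv : IsCritical K 2 3 v) (h2 : r + 1 ≤ K.h 2 v) (h3 : r + 1 ≤ K.h 3 v)
    (hu : applyStr K (diagStr r) v = some u) :
    applyStr K (diagStr (r + 1)) v = applyStr K [2, 3, 3, 2] u := by
  induction r generalizing v with
  | zero =>
    obtain rfl : v = u := Option.some.inj hu
    rfl
  | succ r ih =>
    obtain ⟨w, -, -, hcw, hw2, hw3, hd⟩ :=
      diagStr_succ_of_isCritical hK hv (by omega) (by omega)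
    rw [hd (r + 1) h2]
    exact ih hcw (by omega) (by omega) ((hd r (by omega)).symm.trans hu)

/-- A permutation of the vertices interchanging the colors `2` and `3`. -/
def SwapsColors (K : PreGraph) (τ : K.V → K.V) : Prop :=
  Function.Surjective τ ∧
  (∀ u v, K.F 2 u = some v ↔ K.F 3 (τ u) = some (τ v)) ∧
  (∀ u v, K.F 3 u = some v ↔ K.F 2 (τ u) = some (τ v))

theorem isSome_optIter_map {f g : K.V → Option K.V} {τ : K.V → K.V}
    (hτ : Function.Surjective τ) (hfg : ∀ u v, f u = some v ↔ g (τ u) = some (τ v))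
    (k : ℕ) (v : K.V) :
    (optIter f k v).isSome = (optIter g k (τ v)).isSome := by
  induction k generalizing v with
  | zero => rfl
  | succ k ih =>
    simp only [optIter]
    cases hf : f v with
    | some w => simpa [(hfg v w).1 hf] using ih w
    | none =>
      cases hg : g (τ v) with
      | none => rfl
      | some w =>
        obtain ⟨w', rfl⟩ := hτ w
        rw [(hfg v w').2 hg] at hf
        cases hf

theorem SwapsColors.h_three {τ : K.V → K.V} (hτ : SwapsColors K τ) (v : K.V) :
    K.h 3 (τ v) = K.h 2 v := by
  unfold PreGraph.h
  simp only [isSome_optIter_map hτ.1 hτ.2.1]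

theorem SwapsColors.h_two {τ : K.V → K.V} (hτ : SwapsColors K τ) (v : K.V) :
    K.h 2 (τ v) = K.h 3 v := by
  unfold PreGraph.h
  simp only [isSome_optIter_map hτ.1 hτ.2.2]

theorem SwapsColors.applyStr_verma {τ : K.V → K.V} (hτ : SwapsColors K τ) {v u : K.V}
    (h : applyStr K [2, 3, 3, 2] v = some u) :
    applyStr K [3, 2, 2, 3] (τ v) = some (τ u) := by
  simp only [applyStr, Option.bind_eq_some_iff] at h
  obtain ⟨a, ha, b, hb, c, hc, d, hd, hdu⟩ := h
  obtain rfl := Option.some.inj hdu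
  simp [applyStr, (hτ.2.1 _ _).1 ha, (hτ.2.2 _ _).1 hb, (hτ.2.2 _ _).1 hc, (hτ.2.1 _ _).1 hd]

theorem applyStr_injective {C : Set ℕ} (hK : IsColored K C) {l : List ℕ} {u u' v : K.V}
    (h : applyStr K l u = some v) (h' : applyStr K l u' = some v) : u = u' := by
  induction l generalizing u u' with
  | nil => exact Option.some.inj (h.trans h'.symm)
  | cons i l ih =>
    simp only [applyStr, Option.bind_eq_some_iff] at h h'
    obtain ⟨a, ha, hav⟩ := h
    obtain ⟨a', ha', hav'⟩ := h'
    obtain rfl := ih hav hav'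
    exact hK.2.2.1 i _ _ _ ha ha'

theorem exists_diagStr (hK : IsCrystalOn K (Set.Icc 2 3)) {τ : K.V → K.V}
    (hτ : SwapsColors K τ) {r : ℕ} {v : K.V} (hv : IsCritical K 2 3 v) (hfix : τ v = v)
    (hr : r ≤ K.h 2 v) :
    ∃ u, applyStr K (diagStr r) v = some u ∧ τ u = u ∧ K.h 2 v = K.h 2 u + r := by
  induction r generalizing v with
  | zero => exact ⟨v, rfl, hfix, rfl⟩
  | succ r ih =>
    have h23 := hτ.h_two v
    rw [hfix] at h23
    obtain ⟨w, hw1, hw2, hcw, hhw, -, hd⟩ :=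
      diagStr_succ_of_isCritical hK hv (by omega) (by omega)
    have hfixw : τ w = w := by
      have h := hτ.applyStr_verma hw1
      rw [hfix, hw2] at h
      exact (Option.some.inj h).symm
    obtain ⟨u, hu, hfu, hhu⟩ := ih hcw hfixw (by omega)
    exact ⟨u, (hd r hr).trans hu, hfu, by omega⟩

/-- A self-complementary vertex which is not a source is `F_2 F_3 F_3 F_2` of another one. -/
theorem exists_pred_of_fixed (hK : IsCrystalOn K (Set.Icc 2 3)) {τ : K.V → K.V}
    (hτ : SwapsColors K τ) {u : K.V} (hu : τ u = u) (hns : ¬ IsSource K u) :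
    ∃ w, τ w = w ∧ applyStr K [2, 3, 3, 2] w = some u := by
  obtain ⟨a, b, ha, hb, hab⟩ :
      ∃ a b, K.F 2 a = some u ∧ K.F 3 b = some u ∧ (K.h 3 a = K.h 2 b) := by
    simp only [IsSource, not_forall, not_not] at hns
    obtain ⟨i, x, hx⟩ := hns
    have hi := mem_of_edge hK.1 hx
    obtain rfl | rfl : i = 2 ∨ i = 3 := by
      rw [Set.mem_Icc] at hi
      omega
    · exact ⟨x, τ x, hx, by simpa [hu] using (hτ.2.1 x u).1 hx, (hτ.h_two x).symm⟩
    · exact ⟨τ x, x, by simpa [hu] using (hτ.2.2 x u).1 hx, hx, hτ.h_three x⟩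
  have h23 := hτ.h_two u
  rw [hu] at h23
  have hla := label_cases hK mem_two mem_three neighb_two_three ha
  have h3 : K.h 3 u = K.h 3 a := by
    rcases hla with h | h
    · exact h.1
    · have := ((hK.2.2.2.1 2 mem_two 3 mem_three neighb_two_three).1.2 a b u ha hb
        (by omega)).1
      omega
  obtain ⟨w, hw1, hw2⟩ := (hK.2.2.2.1 2 mem_two 3 mem_three neighb_two_three).2.2 a b u ha hb
    h3 (by omega)
  simp only [Option.bind_eq_some_iff, Finv_eq_some_iff hK.1] at hw1 hw2
  obtain ⟨x, ⟨y, ⟨z, hz, hy⟩, hx⟩, hw⟩ := hw1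
  obtain ⟨x', ⟨y', ⟨z', hz', hy'⟩, hx'⟩, hw'⟩ := hw2
  have hD : applyStr K [2, 3, 3, 2] w = some u := by simp [applyStr, hz, hy, hx, hw]
  have hDswap : applyStr K [3, 2, 2, 3] w = some u := by simp [applyStr, hz', hy', hx', hw']
  refine ⟨w, ?_, hD⟩
  have h := hτ.applyStr_verma hD
  rw [hu] at h
  exact applyStr_injective hK.1 h hDswap

/-! ### Uniqueness of the source and of the sink -/

/-- Newman's lemma: normal forms are unique in a weakly connected terminating
locally confluent system. -/
theorem normalForm_unique {α : Type} (r : α → α → Prop) (hwf : WellFounded (Function.swap r))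
    (hloc : ∀ a b c, r a b → r a c →
      ∃ d, Relation.ReflTransGen r b d ∧ Relation.ReflTransGen r c d)
    {x y : α} (hxy : Relation.ReflTransGen (fun a b => r a b ∨ r b a) x y)
    (hx : ∀ z, ¬ r x z) (hy : ∀ z, ¬ r y z) : x = y := by
  have hconf : ∀ a b c, Relation.ReflTransGen r a b → Relation.ReflTransGen r a c →
      ∃ d, Relation.ReflTransGen r b d ∧ Relation.ReflTransGen r c d := by
    intro a
    induction a using hwf.induction with
    | _ a ih =>
      intro b c hab hac
      rcases hab.cases_head with rfl | ⟨b', hab', hb'b⟩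
      · exact ⟨c, hac, .refl⟩
      rcases hac.cases_head with rfl | ⟨c', hac', hc'c⟩
      · exact ⟨b, .refl, hab⟩
      obtain ⟨d, hb'd, hc'd⟩ := hloc a b' c' hab' hac'
      obtain ⟨e, hbe, hde⟩ := ih b' hab' b d hb'b hb'd
      obtain ⟨f, hcf, hef⟩ := ih c' hac' c e hc'c (hc'd.trans hde)
      exact ⟨f, hbe.trans hef, hcf⟩
  have hnf : ∀ {z w}, (∀ z', ¬ r z z') → Relation.ReflTransGen r z w → z = w := by
    intro z w hz hzw
    rcases hzw.cases_head with h | ⟨z', h, -⟩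
    · exact h
    · exact absurd h (hz z')
  have hred : Relation.ReflTransGen r y x := by
    clear hy
    induction hxy with
    | refl => exact .refl
    | tail _ hstep ih =>
      rcases hstep with h | h
      · obtain ⟨d, hd1, hd2⟩ := hconf _ _ _ ih (.single h)
        obtain rfl := hnf hx hd1
        exact hd2
      · exact .head h ih
  exact (hnf hy hred).symm

/-- The sum of the two weights drops by one along every edge. -/
theorem weight_lt (hK : IsCrystalOn K (Set.Icc 2 3)) {i : ℕ} {u v : K.V}
    (huv : K.F i u = some v) :
    (K.h 2 v + K.h 3 v : ℤ) - (K.t 2 v + K.t 3 v) <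
      (K.h 2 u + K.h 3 u : ℤ) - (K.t 2 u + K.t 3 u) := by
  have hi := mem_of_edge hK.1 huv
  have h1 := h_eq_succ hK.1 huv
  have h2 := t_eq_succ hK.1 huv
  obtain rfl | rfl : i = 2 ∨ i = 3 := by
    rw [Set.mem_Icc] at hi
    omega
  · have := label_cases hK mem_two mem_three neighb_two_three huv
    omega
  · have := label_cases hK mem_three mem_two neighb_two_three.symm huv
    omega

theorem wellFounded_edge (hK : IsCrystalOn K (Set.Icc 2 3)) :
    WellFounded (fun u v : K.V => ∃ i, K.F i u = some v) := by
  have hfin : Finite K.V := hK.1.1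
  let wt : K.V → ℤ := fun u => (K.h 2 u + K.h 3 u : ℤ) - (K.t 2 u + K.t 3 u)
  have hwf : WellFounded (fun u v : K.V => wt v < wt u) :=
    @Finite.wellFounded_of_trans_of_irrefl _ _ (fun u v : K.V => wt v < wt u)
      ⟨fun _ _ _ h h' => h'.trans h⟩ ⟨fun _ h => lt_irrefl _ h⟩
  exact Subrelation.wf (fun ⟨_, h⟩ => weight_lt hK h) hwf

theorem wellFounded_swap_edge (hK : IsCrystalOn K (Set.Icc 2 3)) :
    WellFounded (fun v u : K.V => ∃ i, K.F i u = some v) := by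
  have hfin : Finite K.V := hK.1.1
  let wt : K.V → ℤ := fun u => (K.h 2 u + K.h 3 u : ℤ) - (K.t 2 u + K.t 3 u)
  have hwf : WellFounded (fun u v : K.V => wt u < wt v) :=
    @Finite.wellFounded_of_trans_of_irrefl _ _ (fun u v : K.V => wt u < wt v)
      ⟨fun _ _ _ h h' => h.trans h'⟩ ⟨fun _ h => lt_irrefl _ h⟩
  exact Subrelation.wf (fun ⟨_, h⟩ => weight_lt hK h) hwf

theorem reflTransGen_of_applyStr {l : List ℕ} {u v : K.V} (h : applyStr K l u = some v) :
    Relation.ReflTransGen (fun a b => ∃ i, K.F i a = some b) u v := by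
  induction l generalizing u with
  | nil => exact Option.some.inj h ▸ .refl
  | cons i l ih =>
    simp only [applyStr, Option.bind_eq_some_iff] at h
    obtain ⟨w, hw, hwv⟩ := h
    exact .head ⟨i, hw⟩ (ih hwv)

theorem neighb_of_mem {i j : ℕ} (hi : i ∈ Set.Icc 2 3) (hj : j ∈ Set.Icc 2 3) (hne : i ≠ j) :
    Neighb i j := by
  rw [Set.mem_Icc] at hi hj
  unfold Neighb
  omega

theorem edge_confluent (hK : IsCrystalOn K (Set.Icc 2 3)) (a b c : K.V)
    (hab : ∃ i, K.F i a = some b) (hac : ∃ i, K.F i a = some c) :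
    ∃ d, Relation.ReflTransGen (fun x y => ∃ i, K.F i x = some y) b d ∧
      Relation.ReflTransGen (fun x y => ∃ i, K.F i x = some y) c d := by
  obtain ⟨i, hi⟩ := hab
  obtain ⟨j, hj⟩ := hac
  by_cases hij : i = j
  · subst hij
    obtain rfl := Option.some.inj (hi.symm.trans hj)
    exact ⟨b, .refl, .refl⟩
  have hi' := mem_of_edge hK.1 hi
  have hj' := mem_of_edge hK.1 hj
  have hn := neighb_of_mem hi' hj' hij
  rcases label_cases hK hi' hj' hn hi with h | h
  · obtain ⟨-, w, hw1, hw2⟩ := (hK.2.2.2.1 i hi' j hj' hn).1.1 a b c hi hj h.1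
    exact ⟨w, .single ⟨j, hw1⟩, .single ⟨i, hw2⟩⟩
  rcases label_cases hK hj' hi' hn.symm hj with h' | h'
  · obtain ⟨-, w, hw1, hw2⟩ := (hK.2.2.2.1 j hj' i hi' hn.symm).1.1 a c b hj hi h'.1
    exact ⟨w, .single ⟨j, hw2⟩, .single ⟨i, hw1⟩⟩
  obtain ⟨w, hw1, hw2⟩ := (hK.2.2.2.1 i hi' j hj' hn).2.1 a b c hi hj (by omega) (by omega)
  refine ⟨w, reflTransGen_of_applyStr (l := [j, j, i]) ?_,
    reflTransGen_of_applyStr (l := [i, i, j]) ?_⟩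
  · simpa [applyStr, hi, Option.bind_assoc] using hw1
  · simpa [applyStr, hj, Option.bind_assoc] using hw2

theorem edge_coconfluent (hK : IsCrystalOn K (Set.Icc 2 3)) (a b c : K.V)
    (hba : ∃ i, K.F i b = some a) (hca : ∃ i, K.F i c = some a) :
    ∃ d, Relation.ReflTransGen (fun x y => ∃ i, K.F i y = some x) b d ∧
      Relation.ReflTransGen (fun x y => ∃ i, K.F i y = some x) c d := by
  obtain ⟨i, hi⟩ := hba
  obtain ⟨j, hj⟩ := hca
  by_cases hij : i = j
  · subst hij
    obtain rfl := hK.1.2.2.1 i _ _ _ hi hj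
    exact ⟨b, .refl, .refl⟩
  have hi' := mem_of_edge hK.1 hi
  have hj' := mem_of_edge hK.1 hj
  have hn := neighb_of_mem hi' hj' hij
  rcases label_cases hK hi' hj' hn hi with h | h
  swap
  · obtain ⟨-, w, hw1, hw2⟩ := (hK.2.2.2.1 i hi' j hj' hn).1.2 b c a hi hj (by omega)
    exact ⟨w, .single ⟨j, hw1⟩, .single ⟨i, hw2⟩⟩
  rcases label_cases hK hj' hi' hn.symm hj with h' | h'
  swap
  · obtain ⟨-, w, hw1, hw2⟩ := (hK.2.2.2.1 j hj' i hi' hn.symm).1.2 c b a hj hi (by omega)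
    exact ⟨w, .single ⟨j, hw2⟩, .single ⟨i, hw1⟩⟩
  obtain ⟨w, hw1, hw2⟩ := (hK.2.2.2.1 i hi' j hj' hn).2.2 b c a hi hj h.1 h'.1
  simp only [Option.bind_eq_some_iff, Finv_eq_some_iff hK.1] at hw1 hw2
  obtain ⟨x, ⟨y, ⟨z, hz, hy⟩, hx⟩, hw⟩ := hw1
  obtain ⟨x', ⟨y', ⟨z', hz', hy'⟩, hx'⟩, hw'⟩ := hw2
  obtain rfl := hK.1.2.2.1 i _ _ _ hz hi
  obtain rfl := hK.1.2.2.1 j _ _ _ hz' hj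
  exact ⟨w, .head ⟨j, hy⟩ (.head ⟨j, hx⟩ (.single ⟨i, hw⟩)),
    .head ⟨i, hy'⟩ (.head ⟨i, hx'⟩ (.single ⟨j, hw'⟩))⟩

theorem IsSource.unique (hK : IsCrystalOn K (Set.Icc 2 3)) {s s' : K.V} (hs : IsSource K s)
    (hs' : IsSource K s') : s = s' := by
  refine normalForm_unique (fun x y => ∃ i, K.F i y = some x) (wellFounded_edge hK)
    (edge_coconfluent hK) (Relation.ReflTransGen.mono ?_ _ _ (hK.2.1 s s'))
    (fun z ⟨i, h⟩ => hs i z h)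
    (fun z ⟨i, h⟩ => hs' i z h)
  rintro a b ⟨i, h | h⟩
  · exact Or.inr ⟨i, h⟩
  · exact Or.inl ⟨i, h⟩

theorem IsSink.unique (hK : IsCrystalOn K (Set.Icc 2 3)) {s s' : K.V} (hs : IsSink K s)
    (hs' : IsSink K s') : s = s' := by
  refine normalForm_unique (fun x y => ∃ i, K.F i x = some y) (wellFounded_swap_edge hK)
    (edge_confluent hK) (Relation.ReflTransGen.mono ?_ _ _ (hK.2.1 s s'))
    (fun z ⟨i, h⟩ => by simp [hs i] at h)
    (fun z ⟨i, h⟩ => by simp [hs' i] at h)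
  rintro a b ⟨i, h | h⟩
  · exact Or.inl ⟨i, h⟩
  · exact Or.inr ⟨i, h⟩

theorem SwapsColors.source_fixed (hK : IsCrystalOn K (Set.Icc 2 3)) {τ : K.V → K.V}
    (hτ : SwapsColors K τ) {s : K.V} (hs : IsSource K s) : τ s = s := by
  refine IsSource.unique hK ?_ hs
  intro i u hu
  have hi := mem_of_edge hK.1 hu
  obtain ⟨u, rfl⟩ := hτ.1 u
  obtain rfl | rfl : i = 2 ∨ i = 3 := by
    rw [Set.mem_Icc] at hi
    omega
  · exact hs 3 u ((hτ.2.2 _ _).2 hu)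
  · exact hs 2 u ((hτ.2.1 _ _).2 hu)

theorem SwapsColors.sink_fixed (hK : IsCrystalOn K (Set.Icc 2 3)) {τ : K.V → K.V}
    (hτ : SwapsColors K τ) {s : K.V} (hs : IsSink K s) : τ s = s := by
  refine IsSink.unique hK ?_ hs
  intro i
  cases hu : K.F i (τ s) with
  | none => rfl
  | some u =>
    have hi := mem_of_edge hK.1 hu
    obtain ⟨u, rfl⟩ := hτ.1 u
    obtain rfl | rfl : i = 2 ∨ i = 3 := by
      rw [Set.mem_Icc] at hi
      omega
    · have := (hτ.2.2 _ _).2 hu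
      simp [hs 3] at this
    · have := (hτ.2.1 _ _).2 hu
      simp [hs 2] at this

/-- The self-complementary vertices are the diagonal ones. -/
theorem SwapsColors.fixed_iff (hK : IsCrystalOn K (Set.Icc 2 3)) {τ : K.V → K.V}
    (hτ : SwapsColors K τ) {s : K.V} (hs : IsSource K s) (u : K.V) :
    τ u = u ↔ ∃ r, r ≤ K.h 2 s ∧ applyStr K (diagStr r) s = some u := by
  have hcrit := hs.isCritical hK mem_two mem_three neighb_two_three
  have hfix := hτ.source_fixed hK hs
  constructor
  · intro hu
    induction u using (wellFounded_edge hK).transGen.induction with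
    | _ u ih =>
      by_cases hus : IsSource K u
      · obtain rfl := hus.unique hK hs
        exact ⟨0, Nat.zero_le _, rfl⟩
      · obtain ⟨w, hw, hwu⟩ := exists_pred_of_fixed hK hτ hu hus
        have hne : w ≠ u := by
          rintro rfl
          simp only [applyStr, Option.bind_eq_some_iff] at hwu
          obtain ⟨a, ha, b, hb, c, hc, d, hd, hdu⟩ := hwu
          obtain rfl := Option.some.inj hdu
          have h1 := weight_lt hK ha
          have h2 := weight_lt hK hb
          have h3 := weight_lt hK hc
          have h4 := weight_lt hK hd
          omega
        have hlt := (Relation.reflTransGen_iff_eq_or_transGen.1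
          (reflTransGen_of_applyStr hwu)).resolve_left hne.symm
        obtain ⟨r, hr, hrw⟩ := ih w hlt hw
        obtain ⟨w', hw', -, hh⟩ := exists_diagStr hK hτ hcrit hfix hr
        obtain rfl := Option.some.inj (hrw.symm.trans hw')
        have hpos : 0 < K.h 2 w := by
          simp only [applyStr, Option.bind_eq_some_iff] at hwu
          obtain ⟨a, ha, -⟩ := hwu
          rw [h_eq_succ hK.1 ha]
          omega
        have h23 := hτ.h_two s
        rw [hfix] at h23
        refine ⟨r + 1, by omega, ?_⟩
        rw [diagStr_succ_apply hK hcrit (by omega) (by omega) hrw, hwu]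
  · rintro ⟨r, hr, hru⟩
    obtain ⟨u', hu', hfu, -⟩ := exists_diagStr hK hτ hcrit hfix hr
    obtain rfl := Option.some.inj (hru.symm.trans hu')
    exact hfu

theorem le_h_of_applyStr_diagStr (hK : IsCrystalOn K (Set.Icc 2 3)) {s u : K.V}
    (hs : IsSource K s) {r : ℕ} (hu : applyStr K (diagStr r) s = some u) : r ≤ K.h 2 s := by
  unfold diagStr at hu
  rw [applyStr_append, Option.bind_eq_some_iff] at hu
  obtain ⟨w, hw, -⟩ := hu
  exact (hs.isCritical hK mem_two mem_three neighb_two_three).le_h_of_applyStr hK mem_two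
    mem_three neighb_two_three hw

theorem SwapsColors.ncard_fixed (hK : IsCrystalOn K (Set.Icc 2 3)) {τ : K.V → K.V}
    (hτ : SwapsColors K τ) {s : K.V} (hs : IsSource K s) :
    Set.ncard {u | τ u = u} = K.h 2 s + 1 := by
  have hcrit := hs.isCritical hK mem_two mem_three neighb_two_three
  have hfix := hτ.source_fixed hK hs
  have hex : ∀ r : Fin (K.h 2 s + 1),
      ∃ u, applyStr K (diagStr r) s = some u ∧ τ u = u ∧ K.h 2 s = K.h 2 u + r :=
    fun r => exists_diagStr hK hτ hcrit hfix (Nat.lt_succ_iff.1 r.2)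
  choose g hg hgfix hgh using hex
  have hinj : Function.Injective g := by
    intro a b hab
    have ha := hgh a
    have hb := hgh b
    rw [hab] at ha
    exact Fin.ext (by omega)
  have hset : {u | τ u = u} = Set.range g := by
    ext u
    rw [Set.mem_ofPred_eq, hτ.fixed_iff hK hs u]
    constructor
    · rintro ⟨r, hr, hru⟩
      exact ⟨⟨r, Nat.lt_succ_iff.2 hr⟩, Option.some.inj ((hg _).symm.trans hru)⟩
    · rintro ⟨r, rfl⟩
      exact ⟨r, Nat.lt_succ_iff.1 r.2, hg r⟩
  rw [hset, ← Nat.card_coe_set_eq, Nat.card_range_of_injective hinj, Nat.card_fin]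

/-! ### Subcrystals -/

variable {I : Set ℕ} {v : K.V}

/-- The inclusion of a subcrystal. -/
def subVal (u : (K.sub I v).V) : K.V := u.1

theorem subVal_injective : Function.Injective (subVal : (K.sub I v).V → K.V) :=
  Subtype.val_injective

theorem inComp_subVal (u : (K.sub I v).V) : inComp K I v (subVal u) := u.2

/-- A vertex of the component of `v`, as a vertex of the subcrystal. -/
def subMk (w : K.V) (hw : inComp K I v w) : (K.sub I v).V := ⟨w, hw⟩

theorem map_sub_F {i : ℕ} (hi : i ∈ I) (u : (K.sub I v).V) :
    ((K.sub I v).F i u).map subVal = K.F i (subVal u) := by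
  have hpb : ∀ (o : Option K.V) (f : ∀ w, w ∈ o → inComp K I v w),
      (o.pbind fun w hw => some (subMk w (f w hw))).map subVal = o := by
    intro o f
    cases o <;> rfl
  have hF : (K.sub I v).F i u = (K.F i (subVal u)).pbind fun w hw =>
      some (subMk w ((inComp_subVal u).tail ⟨i, hi, Or.inl (Option.mem_def.mp hw)⟩)) :=
    dif_pos hi
  exact (congrArg (Option.map subVal) hF).trans (hpb _ _)

theorem sub_F_eq_some_iff {i : ℕ} (hi : i ∈ I) (u w : (K.sub I v).V) :
    (K.sub I v).F i u = some w ↔ K.F i (subVal u) = some (subVal w) := by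
  rw [← map_sub_F hi, ← Option.map_some (f := subVal)]
  exact (Option.map_injective subVal_injective).eq_iff.symm

theorem map_bind_of_semiconj {α β : Type} {φ : α → β} {f : α → Option α}
    {g : β → Option β} (h : ∀ a, (f a).map φ = g (φ a)) (o : Option α) :
    (o.bind f).map φ = (o.map φ).bind g := by
  cases o with
  | none => rfl
  | some a => exact h a

theorem map_sub_optIter {i : ℕ} (hi : i ∈ I) (k : ℕ) (u : (K.sub I v).V) :
    (optIter ((K.sub I v).F i) k u).map subVal = optIter (K.F i) k (subVal u) := by
  induction k generalizing u with
  | zero => rfl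
  | succ k ih =>
    simp only [optIter]
    rw [← map_sub_F hi]
    exact map_bind_of_semiconj ih _

theorem sub_h {i : ℕ} (hi : i ∈ I) (u : (K.sub I v).V) :
    (K.sub I v).h i u = K.h i (subVal u) := by
  unfold PreGraph.h
  simp only [← map_sub_optIter hi, Option.isSome_map]

theorem inComp_of_edge {i : ℕ} (hi : i ∈ I) {u w : K.V} (huw : K.F i u = some w)
    (hw : inComp K I v w) : inComp K I v u :=
  hw.tail ⟨i, hi, Or.inr huw⟩

theorem inComp_of_optIter {i : ℕ} (hi : i ∈ I) {k : ℕ} {u w : K.V}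
    (huw : optIter (K.F i) k u = some w) (hw : inComp K I v w) : inComp K I v u := by
  induction k generalizing u with
  | zero => exact Option.some.inj huw ▸ hw
  | succ k ih =>
    simp only [optIter, Option.bind_eq_some_iff] at huw
    obtain ⟨x, hx, hxw⟩ := huw
    exact inComp_of_edge hi hx (ih hxw)

theorem sub_t {i : ℕ} (hi : i ∈ I) (u : (K.sub I v).V) :
    (K.sub I v).t i u = K.t i (subVal u) := by
  unfold PreGraph.t
  congr 1
  ext k
  constructor
  · rintro ⟨w, hw⟩
    exact ⟨(subVal w), by rw [← map_sub_optIter hi, hw]; rfl⟩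
  · rintro ⟨w, hw⟩
    refine ⟨subMk w (inComp_of_optIter hi hw (inComp_subVal u)), ?_⟩
    apply Option.map_injective subVal_injective
    rw [map_sub_optIter hi]
    exact hw

theorem sub_connected (v : K.V) : (K.sub I v).Connected := by
  let v0 : (K.sub I v).V := subMk v .refl
  have hsymm : ∀ {a b}, Relation.ReflTransGen (K.sub I v).Step a b →
      Relation.ReflTransGen (K.sub I v).Step b a := by
    intro a b hab
    have : Std.Symm (K.sub I v).Step := ⟨fun x y ⟨i, h⟩ => ⟨i, h.symm⟩⟩
    exact symm hab
  have hreach : ∀ u (hu : inComp K I v u),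
      Relation.ReflTransGen (K.sub I v).Step v0 (subMk u hu) := by
    intro u hu
    induction hu with
    | refl => exact .refl
    | tail hab hstep ih =>
      refine .tail ih ?_
      obtain ⟨i, hi, h⟩ := hstep
      exact ⟨i, h.imp (sub_F_eq_some_iff hi _ _).2 (sub_F_eq_some_iff hi _ _).2⟩
  exact fun a b => (hsymm (hreach (subVal a) (inComp_subVal a))).trans
    (hreach (subVal b) (inComp_subVal b))

theorem sub_isColored {C : Set ℕ} (hK : IsColored K C) (v : K.V) :
    IsColored (K.sub I v) I := by
  have hfin : Finite K.V := hK.1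
  have hcol : (K.sub I v).ColorsIn I := fun i hi u => by simp [PreGraph.sub, hi]
  refine ⟨Subtype.finite, hcol, ?_, ?_⟩
  · intro i u u' w hu hu'
    by_cases hi : i ∈ I
    · rw [sub_F_eq_some_iff hi] at hu hu'
      exact subVal_injective (hK.2.2.1 i _ _ _ hu hu')
    · rw [hcol i hi] at hu
      cases hu
  · intro i u k hk hu
    by_cases hi : i ∈ I
    · refine hK.2.2.2 i (subVal u) k hk ?_
      rw [← map_sub_optIter hi, hu]
      rfl
    · obtain ⟨k, rfl⟩ := Nat.exists_eq_succ_of_ne_zero hk.ne'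
      simp [optIter, hcol i hi u] at hu

theorem map_sub_Finv {C : Set ℕ} (hK : IsColored K C) {i : ℕ} (hi : i ∈ I)
    (u : (K.sub I v).V) :
    ((K.sub I v).Finv i u).map subVal = K.Finv i (subVal u) := by
  ext w
  rw [Finv_eq_some_iff hK, Option.map_eq_some_iff]
  constructor
  · rintro ⟨x, hx, rfl⟩
    rw [Finv_eq_some_iff (sub_isColored hK v)] at hx
    exact (sub_F_eq_some_iff hi _ _).1 hx
  · intro hw
    refine ⟨subMk w (inComp_of_edge hi hw (inComp_subVal u)), ?_, rfl⟩
    rw [Finv_eq_some_iff (sub_isColored hK v)]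
    exact (sub_F_eq_some_iff hi _ _).2 hw

theorem sub_A2at {i j : ℕ} (hi : i ∈ I) (hj : j ∈ I) (h : A2at K i j) :
    A2at (K.sub I v) i j := by
  refine ⟨fun u w huw => ?_, fun u w x huw hwx => ?_⟩
  · simp only [sub_h hj, sub_t hj]
    exact h.1 _ _ ((sub_F_eq_some_iff hi _ _).1 huw)
  · simp only [sub_h hj]
    exact h.2 _ _ _ ((sub_F_eq_some_iff hi _ _).1 huw) ((sub_F_eq_some_iff hi _ _).1 hwx)

theorem sub_A3at {i j : ℕ} (hi : i ∈ I) (hj : j ∈ I) (h : A3at K i j) :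
    A3at (K.sub I v) i j := by
  refine ⟨fun u w w' hw hw' hl => ?_, fun u u' w hu hu' hl => ?_⟩
  · simp only [sub_h hj, sub_h hi] at hl ⊢
    obtain ⟨h1, x, hx, hx'⟩ := h.1 _ _ _ ((sub_F_eq_some_iff hi _ _).1 hw)
      ((sub_F_eq_some_iff hj _ _).1 hw') hl
    exact ⟨h1, subMk x ((inComp_subVal w).tail ⟨j, hj, Or.inl hx⟩), (sub_F_eq_some_iff hj _ _).2 hx,
      (sub_F_eq_some_iff hi _ _).2 hx'⟩
  · simp only [sub_h hj, sub_h hi] at hl ⊢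
    obtain ⟨h1, x, hx, hx'⟩ := h.2 _ _ _ ((sub_F_eq_some_iff hi _ _).1 hu)
      ((sub_F_eq_some_iff hj _ _).1 hu') hl
    exact ⟨h1, subMk x (inComp_of_edge hj hx (inComp_subVal u)), (sub_F_eq_some_iff hj _ _).2 hx,
      (sub_F_eq_some_iff hi _ _).2 hx'⟩

theorem exists_common_of_map {α β : Type} {φ : α → β} (hφ : Function.Injective φ)
    {o o' : Option α} (h : ∃ w, o.map φ = some w ∧ o'.map φ = some w) :
    ∃ w, o = some w ∧ o' = some w := by
  obtain ⟨w, h1, h2⟩ := h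
  obtain ⟨x, hx, rfl⟩ := Option.map_eq_some_iff.1 h1
  refine ⟨x, hx, Option.map_injective hφ ?_⟩
  rw [h2]
  rfl

theorem sub_A4at {C : Set ℕ} (hK : IsColored K C) {i j : ℕ} (hi : i ∈ I) (hj : j ∈ I)
    (h : A4at K i j) : A4at (K.sub I v) i j := by
  refine ⟨fun u w w' hw hw' hl hl' => ?_, fun u u' w hu hu' hl hl' => ?_⟩
  · simp only [sub_h hj, sub_h hi] at hl hl'
    apply exists_common_of_map subVal_injective
    simp only [map_bind_of_semiconj (map_sub_F hi), map_bind_of_semiconj (map_sub_F hj), map_sub_F hi,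
      map_sub_F hj]
    exact h.1 _ _ _ ((sub_F_eq_some_iff hi _ _).1 hw) ((sub_F_eq_some_iff hj _ _).1 hw') hl hl'
  · simp only [sub_h hj, sub_h hi] at hl hl'
    apply exists_common_of_map subVal_injective
    simp only [map_bind_of_semiconj (map_sub_Finv hK hi), map_bind_of_semiconj (map_sub_Finv hK hj),
      map_sub_Finv hK hi, map_sub_Finv hK hj]
    exact h.2 _ _ _ ((sub_F_eq_some_iff hi _ _).1 hu) ((sub_F_eq_some_iff hj _ _).1 hu') hl hl'

theorem sub_isCrystalOn (hK : IsACrystal 4 K) (v : K.V) :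
    IsCrystalOn (K.sub (Set.Icc 2 3) v) (Set.Icc 2 3) := by
  have hsub : ∀ i ∈ Set.Icc 2 3, i ∈ Set.Icc 1 4 := by
    intro i hi
    rw [Set.mem_Icc] at hi ⊢
    omega
  refine ⟨sub_isColored hK.1 v, sub_connected v, fun i hi j hj hij => ?_,
    fun i hi j hj hn => ?_, fun i hi j hj hf => ?_⟩
  · exact sub_A2at hi hj (hK.2.2.1 i (hsub i hi) j (hsub j hj) hij)
  · have h := hK.2.2.2.1 i (hsub i hi) j (hsub j hj) hn
    exact ⟨sub_A3at hi hj h.1, sub_A4at hK.1 hi hj h.2⟩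
  · rw [Set.mem_Icc] at hi hj
    unfold Far at hf
    omega

/-- The color-reversing involution preserves the middle subcrystal of a fixed vertex. -/
theorem inComp_map {σ : K.V → K.V}
    (hσ : ∀ (i : ℕ) (u v : K.V), K.F i u = some v ↔ K.F (5 - i) (σ u) = some (σ v))
    (hv : σ v = v) {u : K.V} (hu : inComp K (Set.Icc 2 3) v u) :
    inComp K (Set.Icc 2 3) v (σ u) := by
  induction hu with
  | refl =>
    rw [hv]
    exact .refl
  | tail _ hstep ih =>
    refine .tail ih ?_
    obtain ⟨i, hi, h⟩ := hstep
    rw [Set.mem_Icc] at hi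
    exact ⟨5 - i, ⟨by omega, by omega⟩, h.imp (hσ i _ _).1 (hσ i _ _).1⟩

/-- The restriction of `σ` to the middle subcrystal of a fixed vertex. -/
def subMap {σ : K.V → K.V}
    (hσ : ∀ (i : ℕ) (u v : K.V), K.F i u = some v ↔ K.F (5 - i) (σ u) = some (σ v))
    (hv : σ v = v) (u : (K.sub (Set.Icc 2 3) v).V) : (K.sub (Set.Icc 2 3) v).V :=
  subMk (σ (subVal u)) (inComp_map hσ hv (inComp_subVal u))

theorem subMap_eq_iff {σ : K.V → K.V}
    (hσ : ∀ (i : ℕ) (u v : K.V), K.F i u = some v ↔ K.F (5 - i) (σ u) = some (σ v))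
    (hv : σ v = v) (u w : (K.sub (Set.Icc 2 3) v).V) :
    subMap hσ hv u = w ↔ σ (subVal u) = subVal w :=
  Subtype.ext_iff

theorem swapsColors_sub (hfin : Finite K.V) {σ : K.V → K.V} (hσi : Function.Injective σ)
    (hσ : ∀ (i : ℕ) (u v : K.V), K.F i u = some v ↔ K.F (5 - i) (σ u) = some (σ v))
    (hv : σ v = v) :
    SwapsColors (K.sub (Set.Icc 2 3) v) (subMap hσ hv) := by
  refine ⟨?_, fun u w => ?_, fun u w => ?_⟩
  · have : Finite (K.sub (Set.Icc 2 3) v).V := Subtype.finite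
    refine Finite.surjective_of_injective fun a b hab => ?_
    exact subVal_injective (hσi (congrArg subVal hab))
  · rw [sub_F_eq_some_iff mem_two, sub_F_eq_some_iff mem_three]
    exact hσ 2 _ _
  · rw [sub_F_eq_some_iff mem_two, sub_F_eq_some_iff mem_three]
    exact hσ 3 _ _

end Crystal

/-- the middle subcrystal (colors 2, 3) through a self-complementary vertex
of a symmetric `A_4`-crystal has self-complementary source and sink, is a symmetric
`A_2`-crystal, and its self-complementary vertices are exactly the diagonal vertices
`(F_2 F_3)^r (F_3 F_2)^r (stil)`; in particular there are exactly `g_2 + 1` of them. -/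
theorem A4_middle_subcrystal
    (K : PreGraph) (hK : IsACrystal 4 K)
    (s : K.V) (hs : IsSource K s)
    (c : ℕ → ℕ) (hc : ∀ i, 1 ≤ i → i ≤ 4 → K.h i s = c i)
    (hsym1 : c 4 = c 1) (hsym2 : c 3 = c 2)
    (σ : K.V → K.V) (hσb : Function.Bijective σ)
    (hσ : ∀ (i : ℕ) (u v : K.V), K.F i u = some v ↔ K.F (5 - i) (σ u) = some (σ v))
    (v : K.V) (hv : σ v = v)
    (stil ttil : (K.sub (Set.Icc 2 3) v).V)
    (hst : IsSource (K.sub (Set.Icc 2 3) v) stil)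
    (htt : IsSink (K.sub (Set.Icc 2 3) v) ttil) :
    σ stil.1 = stil.1 ∧ σ ttil.1 = ttil.1 ∧
    IsCrystalOn (K.sub (Set.Icc 2 3) v) (Set.Icc 2 3) ∧
    (K.sub (Set.Icc 2 3) v).h 2 stil = (K.sub (Set.Icc 2 3) v).h 3 stil ∧
    (∀ u : (K.sub (Set.Icc 2 3) v).V,
      σ u.1 = u.1 ↔ ∃ r : ℕ, applyStr (K.sub (Set.Icc 2 3) v) (diagStr r) stil = some u) ∧
    Set.ncard {u : (K.sub (Set.Icc 2 3) v).V | σ u.1 = u.1} =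
      (K.sub (Set.Icc 2 3) v).h 2 stil + 1 := by
  have hL := sub_isCrystalOn hK v
  have hτ := swapsColors_sub hK.1.1 hσb.injective hσ hv
  have hs0 := hτ.source_fixed hL hst
  have hfix : ∀ u, subMap hσ hv u = u ↔ σ u.1 = u.1 := fun u => subMap_eq_iff hσ hv u u
  refine ⟨(hfix _).1 hs0, (hfix _).1 (hτ.sink_fixed hL htt), hL, ?_, fun u => ?_, ?_⟩
  · have h := hτ.h_two stil
    rwa [hs0] at h
  · refine (hfix u).symm.trans ((hτ.fixed_iff hL hst u).trans ?_)
    exact ⟨fun ⟨r, _, hr⟩ => ⟨r, hr⟩, fun ⟨r, hr⟩ => ⟨r, le_h_of_applyStr_diagStr hL hst hr, hr⟩⟩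
  · rw [← hτ.ncard_fixed hL hst]
    congr 1
    ext u
    exact (hfix u).symm
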